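/- Let A : ℝ^m → ℝ^{n×n} be a continuously differentiable matrix-valued map and let δ₀ ∈ ℝ^m. Suppose every active eigenvalue of A(δ₀), i.e. every root λ ∈ ℂ of the characteristic polynomial of A(δ₀) with Re λ = α(A(δ₀)), is a simple root of that characteristic polynomial. Then there exist an open neighborhood U of δ₀ and finitely many continuously differentiable functions f₁, …, f_p : U → ℝ (p ≥ 1) such that α(A(δ)) = max{f₁(δ), …, f_p(δ)} for every δ ∈ U. -/

import Mathlib

noncomputable section

/-- The spectral abscissa of a real square matrix: the largest real part of a root in `ℂ`
of its characteristic polynomial. -/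
def specAbscissa {n : ℕ} (M : Matrix (Fin n) (Fin n) ℝ) : ℝ :=
  sSup (Complex.re '' {z : ℂ | (M.charpoly.map (algebraMap ℝ ℂ)).IsRoot z})

open Filter Topology

/-- Every complex root of the characteristic polynomial is bounded by the sum of the absolute
values of the entries. -/
theorem norm_le_sum_abs_of_isRoot_charpoly {n : ℕ} {M : Matrix (Fin n) (Fin n) ℝ} {z : ℂ}
    (hz : (M.charpoly.map (algebraMap ℝ ℂ)).IsRoot z) : ‖z‖ ≤ ∑ i, ∑ j, |M i j| := by
  rw [← Matrix.charpoly_map, ← Matrix.charpoly_toLin',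
    ← Module.End.hasEigenvalue_iff_isRoot_charpoly] at hz
  obtain ⟨k, hk⟩ := eigenvalue_mem_ball hz
  rw [mem_closedBall_iff_norm] at hk
  have hrow : ‖z‖ ≤ ∑ j, |M k j| := by
    rw [← Finset.add_sum_erase _ _ (Finset.mem_univ k)]
    simp only [Matrix.map_apply, Complex.coe_algebraMap, Complex.norm_real,
      Real.norm_eq_abs] at hk
    have hadd := norm_le_norm_add_norm_sub' z (M k k : ℂ)
    rw [Complex.norm_real, Real.norm_eq_abs] at hadd
    linarith
  exact hrow.trans (Finset.single_le_sum (f := fun i => ∑ j, |M i j|)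
    (fun i _ => Finset.sum_nonneg fun j _ => abs_nonneg _) (Finset.mem_univ k))

theorem contDiff_eval_charpoly {E : Type*} [NormedAddCommGroup E] [NormedSpace ℝ E] {n : ℕ}
    {r : WithTop ℕ∞} {A : E → Matrix (Fin n) (Fin n) ℝ}
    (hA : ∀ i j, ContDiff ℝ r fun δ => A δ i j) :
    ContDiff ℝ r fun v : E × ℂ => ((A v.1).charpoly.map (algebraMap ℝ ℂ)).eval v.2 := by
  simp only [← Matrix.charpoly_map, Matrix.eval_charpoly, Matrix.det_apply]
  refine ContDiff.sum fun σ _ => ContDiff.const_smul _ (contDiff_prod fun i _ => ?_)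
  simp only [Matrix.sub_apply, Matrix.scalar_apply, Matrix.map_apply, Matrix.diagonal_apply]
  refine ContDiff.sub ?_ (Complex.ofRealCLM.contDiff.comp ((hA _ _).comp contDiff_fst))
  split_ifs
  · exact contDiff_snd
  · exact contDiff_const

/-- A simple root of the characteristic polynomial extends to a continuously differentiable
branch, which locally parametrizes all roots. -/
theorem exists_contDiffAt_root_branch {E : Type*} [NormedAddCommGroup E] [NormedSpace ℝ E]
    [CompleteSpace E] {n : ℕ} {A : E → Matrix (Fin n) (Fin n) ℝ}
    (hA : ∀ i j, ContDiff ℝ 1 fun δ => A δ i j) {δ₀ : E} {z : ℂ}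
    (hz : ((A δ₀).charpoly.map (algebraMap ℝ ℂ)).rootMultiplicity z = 1) :
    ∃ ψ : E → ℂ, ContDiffAt ℝ 1 ψ δ₀ ∧ ψ δ₀ = z ∧
      (∀ᶠ δ in 𝓝 δ₀, ((A δ).charpoly.map (algebraMap ℝ ℂ)).IsRoot (ψ δ)) ∧
      ∀ᶠ v : E × ℂ in 𝓝 (δ₀, z),
        ((A v.1).charpoly.map (algebraMap ℝ ℂ)).IsRoot v.2 → v.2 = ψ v.1 := by
  set g : E × ℂ → ℂ := fun v => ((A v.1).charpoly.map (algebraMap ℝ ℂ)).eval v.2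
  set P := (A δ₀).charpoly.map (algebraMap ℝ ℂ)
  have hP0 : P ≠ 0 := ((A δ₀).charpoly_monic.map _).ne_zero
  have hroot : P.IsRoot z := (Polynomial.rootMultiplicity_pos hP0).1 (by omega)
  have hder : P.derivative.eval z ≠ 0 := fun h => by
    have := (Polynomial.one_lt_rootMultiplicity_iff_isRoot hP0).2 ⟨hroot, h⟩
    omega
  have hgC : ContDiffAt ℝ 1 g (δ₀, z) := (contDiff_eval_charpoly hA).contDiffAt
  have hg0 : g (δ₀, z) = 0 := hroot
  have hpartial : fderiv ℝ g (δ₀, z) ∘L .inr ℝ E ℂ =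
      ContinuousLinearMap.mul ℝ ℂ (P.derivative.eval z) := by
    have h₁ : HasFDerivAt (fun w : ℂ => g (δ₀, w)) (fderiv ℝ g (δ₀, z) ∘L .inr ℝ E ℂ) z :=
      (hgC.differentiableAt one_ne_zero).hasFDerivAt.comp z (hasFDerivAt_prodMk_right δ₀ z)
    have h₂ := (P.hasDerivAt z).hasFDerivAt.restrictScalars ℝ
    rw [h₁.unique h₂]
    ext
    simp [mul_comm]
  have hinv : (fderiv ℝ g (δ₀, z) ∘L .inr ℝ E ℂ).IsInvertible := by
    rw [hpartial]
    refine ContinuousLinearMap.IsInvertible.of_inverse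
      (g := ContinuousLinearMap.mul ℝ ℂ (P.derivative.eval z)⁻¹) ?_ ?_ <;>
    · refine ContinuousLinearMap.ext fun w => ?_
      simp [hder]
  refine ⟨hgC.implicitFunction one_ne_zero hinv,
    hgC.contDiffAt_implicitFunction one_ne_zero hinv,
    hgC.implicitFunction_apply_self one_ne_zero hinv, ?_, ?_⟩
  · filter_upwards [hgC.eventually_apply_implicitFunction one_ne_zero hinv] with δ hδ
    exact hδ.trans hg0
  · filter_upwards [hgC.eventually_apply_eq_iff_implicitFunction one_ne_zero hinv] with v hv h
    exact (hv.1 (h.trans hg0.symm)).symm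

/-- A property holding near every root of the characteristic polynomial of `A δ₀` holds for all
roots of the characteristic polynomial of `A δ` when `δ` is close to `δ₀`. -/
theorem eventually_forall_isRoot_charpoly {E : Type*} [TopologicalSpace E] {n : ℕ}
    {A : E → Matrix (Fin n) (Fin n) ℝ} {δ₀ : E} (hA : ∀ i j, Continuous fun δ => A δ i j)
    (hg : Continuous fun v : E × ℂ => ((A v.1).charpoly.map (algebraMap ℝ ℂ)).eval v.2)
    {Q : E → ℂ → Prop}
    (hQ : ∀ z, ((A δ₀).charpoly.map (algebraMap ℝ ℂ)).IsRoot z →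
      ∀ᶠ v : E × ℂ in 𝓝 (δ₀, z),
        ((A v.1).charpoly.map (algebraMap ℝ ℂ)).IsRoot v.2 → Q v.1 v.2) :
    ∀ᶠ δ in 𝓝 δ₀, ∀ z, ((A δ).charpoly.map (algebraMap ℝ ℂ)).IsRoot z → Q δ z := by
  set B : E → ℝ := fun δ => ∑ i, ∑ j, |A δ i j|
  have hB : Continuous B :=
    continuous_finsetSum _ fun i _ => continuous_finsetSum _ fun j _ => (hA i j).abs
  have hcompact := (isCompact_closedBall (0 : ℂ) (B δ₀ + 1)).eventually_forall_of_forall_eventually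
    (x₀ := δ₀) (P := fun δ z => ((A δ).charpoly.map (algebraMap ℝ ℂ)).IsRoot z → Q δ z) (by
      intro z _
      by_cases hz : ((A δ₀).charpoly.map (algebraMap ℝ ℂ)).IsRoot z
      · exact hQ z hz
      · filter_upwards [hg.continuousAt.eventually_ne (x := (δ₀, z)) hz] with v hv h
        exact absurd h hv)
  filter_upwards [hcompact, hB.continuousAt.eventually_lt_const (lt_add_one (B δ₀))]
    with δ hδ hlt z hz
  refine hδ z ?_ hz
  rw [mem_closedBall_zero_iff]
  exact (norm_le_sum_abs_of_isRoot_charpoly hz).trans hlt.le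

theorem finite_re_image_isRoot_charpoly {n : ℕ} (M : Matrix (Fin n) (Fin n) ℝ) :
    (Complex.re '' {z : ℂ | (M.charpoly.map (algebraMap ℝ ℂ)).IsRoot z}).Finite :=
  (Polynomial.finite_setOfPred_isRoot (M.charpoly_monic.map _).ne_zero).image _

theorem re_le_specAbscissa {n : ℕ} {M : Matrix (Fin n) (Fin n) ℝ} {z : ℂ}
    (hz : (M.charpoly.map (algebraMap ℝ ℂ)).IsRoot z) : z.re ≤ specAbscissa M :=
  le_csSup (finite_re_image_isRoot_charpoly M).bddAbove ⟨z, hz, rfl⟩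

theorem exists_isRoot_re_eq_specAbscissa {n : ℕ} (hn : n ≠ 0) (M : Matrix (Fin n) (Fin n) ℝ) :
    ∃ z : ℂ, (M.charpoly.map (algebraMap ℝ ℂ)).IsRoot z ∧ z.re = specAbscissa M := by
  have hdeg : (M.charpoly.map (algebraMap ℝ ℂ)).degree ≠ 0 := by
    rw [Polynomial.degree_map, Matrix.charpoly_degree_eq_dim, Fintype.card_fin]
    exact_mod_cast hn
  obtain ⟨w, hw⟩ := IsAlgClosed.exists_root _ hdeg
  have hne : (Complex.re '' {z : ℂ | (M.charpoly.map (algebraMap ℝ ℂ)).IsRoot z}).Nonempty :=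
    ⟨_, w, hw, rfl⟩
  exact hne.csSup_mem (finite_re_image_isRoot_charpoly M)

/-- if every active eigenvalue of `A δ₀` is a simple root of the characteristic
polynomial, then near `δ₀` the spectral abscissa `α(A δ)` is the maximum of finitely many
continuously differentiable functions. -/
theorem specAbscissa_local_max_of_C1 (m n : ℕ)
    (A : EuclideanSpace ℝ (Fin m) → Matrix (Fin n) (Fin n) ℝ)
    (hA : ∀ i j, ContDiff ℝ 1 fun δ => A δ i j)
    (δ₀ : EuclideanSpace ℝ (Fin m))
    (hactive : ∀ z : ℂ, ((A δ₀).charpoly.map (algebraMap ℝ ℂ)).IsRoot z →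
      z.re = specAbscissa (A δ₀) →
      Polynomial.rootMultiplicity z ((A δ₀).charpoly.map (algebraMap ℝ ℂ)) = 1) :
    ∃ U : Set (EuclideanSpace ℝ (Fin m)), IsOpen U ∧ δ₀ ∈ U ∧
      ∃ (p : ℕ) (_ : 1 ≤ p) (f : Fin p → EuclideanSpace ℝ (Fin m) → ℝ),
        (∀ i, ContDiffOn ℝ 1 (f i) U) ∧
        ∀ δ ∈ U, IsGreatest (Set.range fun i : Fin p => f i δ) (specAbscissa (A δ)) := by
  rcases eq_or_ne n 0 with rfl | hn
  · refine ⟨Set.univ, isOpen_univ, Set.mem_univ _, 1, le_rfl, fun _ _ => specAbscissa (A δ₀),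
      fun _ => contDiffOn_const, fun δ _ => ?_⟩
    rw [Subsingleton.elim (A δ) (A δ₀)]
    exact ⟨⟨0, rfl⟩, by rintro _ ⟨_, rfl⟩; exact le_rfl⟩
  set S : Set ℂ := {z | ((A δ₀).charpoly.map (algebraMap ℝ ℂ)).IsRoot z ∧
    z.re = specAbscissa (A δ₀)}
  have hS : S.Finite :=
    (Polynomial.finite_setOfPred_isRoot ((A δ₀).charpoly_monic.map _).ne_zero).subset fun _ h => h.1
  obtain ⟨z₀, hz₀⟩ : S.Nonempty := exists_isRoot_re_eq_specAbscissa hn (A δ₀)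
  have : Finite S := hS
  choose ψ hψC hψ₀ hψroot hψuniq using fun z : S =>
    exists_contDiffAt_root_branch hA (hactive z z.2.1 z.2.2)
  have hle : ∀ᶠ δ in 𝓝 δ₀, ∀ z, ((A δ).charpoly.map (algebraMap ℝ ℂ)).IsRoot z →
      ∃ k, z.re ≤ (ψ k δ).re := by
    refine eventually_forall_isRoot_charpoly (fun i j => (hA i j).continuous)
      (contDiff_eval_charpoly hA).continuous fun z hz => ?_
    by_cases hzS : z ∈ S
    · filter_upwards [hψuniq ⟨z, hzS⟩] with v hv h
      exact ⟨⟨z, hzS⟩, by rw [← hv h]⟩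
    · have hlt : z.re < (ψ ⟨z₀, hz₀⟩ δ₀).re := by
        rw [hψ₀, hz₀.2]
        exact lt_of_le_of_ne (re_le_specAbscissa hz) fun h => hzS ⟨hz, h⟩
      have h₁ : ContinuousAt (fun v : EuclideanSpace ℝ (Fin m) × ℂ => v.2.re) (δ₀, z) := by
        fun_prop
      have h₂ : ContinuousAt (fun v : EuclideanSpace ℝ (Fin m) × ℂ => (ψ ⟨z₀, hz₀⟩ v.1).re)
          (δ₀, z) :=
        Complex.continuous_re.continuousAt.comp
          (ContinuousAt.comp (f := Prod.fst) (hψC ⟨z₀, hz₀⟩).continuousAt continuousAt_fst)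
      filter_upwards [h₁.eventually_lt h₂ hlt] with v hv _
      exact ⟨_, hv.le⟩
  have hC : ∀ᶠ δ in 𝓝 δ₀, ∀ k, ContDiffAt ℝ 1 (ψ k) δ :=
    eventually_all.2 fun k => (hψC k).eventually (by simp)
  obtain ⟨U, hU, hUo, hδU⟩ := eventually_nhds_iff.1 ((hle.and hC).and (eventually_all.2 hψroot))
  obtain ⟨p, ⟨e⟩⟩ := Finite.exists_equiv_fin S
  refine ⟨U, hUo, hδU, p, Fin.pos (e ⟨z₀, hz₀⟩), fun i δ => (ψ (e.symm i) δ).re,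
    fun i δ hδ => ?_, fun δ hδ => ?_⟩
  · exact (Complex.reCLM.contDiff.contDiffAt.comp δ ((hU δ hδ).1.2 _)).contDiffWithinAt
  · have hub : ∀ k, (ψ k δ).re ≤ specAbscissa (A δ) := fun k =>
      re_le_specAbscissa ((hU δ hδ).2 k)
    obtain ⟨z, hz, hzα⟩ := exists_isRoot_re_eq_specAbscissa hn (A δ)
    obtain ⟨k, hk⟩ := (hU δ hδ).1.1 z hz
    refine ⟨⟨e k, ?_⟩, ?_⟩
    · simpa using le_antisymm (hub k) (hzα ▸ hk)
    · rintro _ ⟨i, rfl⟩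
      exact hub _
end
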